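/- There exists an absolute constant C > 0 such that the following holds. Let 0 < ε ≤ 1/2, 0 < δ < 1/4, d ≥ 1, and let C₀ > 0. Let 𝒟₁ be a probability distribution on ℝ^{r×n} and 𝒟₂ a probability distribution on ℝ^{m×r} such that: (i) for every M ∈ ℝ^{n×(d+1)}, with probability at least 1 − δ over S ∼ 𝒟₁, (1−ε)‖Mx‖₂ ≤ ‖SMx‖₂ ≤ (1+ε)‖Mx‖₂ for all x ∈ ℝ^{d+1}, and likewise for every M ∈ ℝ^{r×(d+1)} with probability at least 1 − δ over R ∼ 𝒟₂; (ii) for every A ∈ ℝ^{n×d} with full column rank, every a ∈ ℝ^d, and every b ∈ ℝ^n, with probability at least 1 − δ over S ∼ 𝒟₁, the minimum-norm least-squares solution x'_S of min_x ‖SAx − Sb‖₂ satisfies |aᵀx'_S − aᵀx*| ≤ C₀·(ε/√d)·‖a‖₂·‖b − Ax*‖₂ / σ_min(A) where x* = (AᵀA)⁻¹Aᵀb, and likewise for every A ∈ ℝ^{r×d} with full column rank, a ∈ ℝ^d, b ∈ ℝ^r with probability at least 1 − δ over R ∼ 𝒟₂. Then for S ∼ 𝒟₁ and R ∼ 𝒟₂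 drawn independently, for every A ∈ ℝ^{n×d} with full column rank, every a ∈ ℝ^d, and every b ∈ ℝ^n, with probability at least 1 − C·δ, the minimum-norm least-squares solution x'' of min_x ‖RSAx − RSb‖₂ satisfies |aᵀx'' − aᵀx*| ≤ C·C₀·(ε/√d)·‖a‖₂·‖b − Ax*‖₂ / σ_min(A). -/

import Mathlib

open Matrix MeasureTheory

/-- Euclidean norm of a vector in `ℝ^n`. -/
noncomputable def vnorm {n : ℕ} (x : Fin n → ℝ) : ℝ := Real.sqrt (∑ i, x i ^ 2)

/-- Smallest singular value of a matrix: the infimum of `‖Ax‖₂` over unit vectors `x`. -/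
noncomputable def sigmaMin {m n : ℕ} (A : Matrix (Fin m) (Fin n) ℝ) : ℝ :=
  sInf {r : ℝ | ∃ x : Fin n → ℝ, vnorm x = 1 ∧ r = vnorm (A.mulVec x)}

/-- `x` is the minimum-norm least-squares solution of `min_z ‖Mz − y‖₂`: it minimizes
`‖Mx − y‖₂`, and has minimal Euclidean norm among all minimizers. -/
def IsMinNormLS {p k : ℕ} (M : Matrix (Fin p) (Fin k) ℝ) (y : Fin p → ℝ) (x : Fin k → ℝ) :
    Prop :=
  (∀ z, vnorm (M.mulVec x - y) ≤ vnorm (M.mulVec z - y)) ∧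
  (∀ z, (∀ w, vnorm (M.mulVec z - y) ≤ vnorm (M.mulVec w - y)) → vnorm x ≤ vnorm z)

lemma vnorm_nonneg {n : ℕ} (x : Fin n → ℝ) : 0 ≤ vnorm x := Real.sqrt_nonneg _

lemma vnorm_sq {n : ℕ} (x : Fin n → ℝ) : vnorm x ^ 2 = x ⬝ᵥ x := by
  unfold vnorm
  rw [Real.sq_sqrt (Finset.sum_nonneg fun i _ => sq_nonneg (x i))]
  simp [dotProduct, sq]

lemma vnorm_eq_zero {n : ℕ} {x : Fin n → ℝ} : vnorm x = 0 ↔ x = 0 := by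
  rw [← dotProduct_self_eq_zero, ← vnorm_sq, sq_eq_zero_iff]

lemma vnorm_zero {n : ℕ} : vnorm (0 : Fin n → ℝ) = 0 := vnorm_eq_zero.2 rfl

lemma vnorm_sub_comm {n : ℕ} (x y : Fin n → ℝ) : vnorm (x - y) = vnorm (y - x) := by
  simp only [vnorm, Pi.sub_apply, sub_sq_comm]

lemma continuous_vnorm {n : ℕ} : Continuous (vnorm : (Fin n → ℝ) → ℝ) := by
  unfold vnorm
  fun_prop

lemma exists_vnorm_eq_one {d : ℕ} (hd : 1 ≤ d) : ∃ x : Fin d → ℝ, vnorm x = 1 :=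
  ⟨Pi.single ⟨0, hd⟩ 1, by simp [vnorm, Pi.single_apply]⟩

/-- The normal-equations solution of the least-squares problem `min_x ‖Mx − y‖₂`. -/
noncomputable def lsSol {p k : ℕ} (M : Matrix (Fin p) (Fin k) ℝ) (y : Fin p → ℝ) : Fin k → ℝ :=
  ((Mᵀ * M)⁻¹ * Mᵀ).mulVec y

lemma rank_eq_iff_mulVec_injective {p k : ℕ} (M : Matrix (Fin p) (Fin k) ℝ) :
    M.rank = k ↔ Function.Injective M.mulVec := by
  have h := M.mulVecLin.finrank_range_add_finrank_ker
  rw [Module.finrank_fin_fun] at h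
  rw [← Matrix.coe_mulVecLin, ← LinearMap.ker_eq_bot, ← Submodule.finrank_eq_zero (R := ℝ)]
  unfold Matrix.rank
  omega

lemma det_transpose_mul_self_ne_zero {p k : ℕ} {M : Matrix (Fin p) (Fin k) ℝ}
    (hM : Function.Injective M.mulVec) : (Mᵀ * M).det ≠ 0 := by
  rw [← isUnit_iff_ne_zero, ← Matrix.isUnit_iff_isUnit_det, ← Matrix.mulVec_injective_iff_isUnit,
    ← Matrix.coe_mulVecLin, ← LinearMap.ker_eq_bot, LinearMap.ker_eq_bot']
  intro x hx
  rw [Matrix.coe_mulVecLin, ← Matrix.mulVec_mulVec] at hx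
  have h : M.mulVec x ⬝ᵥ M.mulVec x = 0 := by
    rw [Matrix.dotProduct_mulVec, ← Matrix.mulVec_transpose, hx, zero_dotProduct]
  exact hM (by rw [dotProduct_self_eq_zero.1 h, Matrix.mulVec_zero])

lemma vnorm_mulVec_sub_sq {p k : ℕ} {M : Matrix (Fin p) (Fin k) ℝ} (hM : (Mᵀ * M).det ≠ 0)
    (y : Fin p → ℝ) (z : Fin k → ℝ) :
    vnorm (M.mulVec z - y) ^ 2 =
      vnorm (M.mulVec (z - lsSol M y)) ^ 2 + vnorm (M.mulVec (lsSol M y) - y) ^ 2 := by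
  have hnormal : Mᵀ.mulVec (M.mulVec (lsSol M y) - y) = 0 := by
    rw [Matrix.mulVec_sub, lsSol, Matrix.mulVec_mulVec, Matrix.mulVec_mulVec, ← Matrix.mul_assoc,
      Matrix.mul_nonsing_inv _ (isUnit_iff_ne_zero.2 hM), Matrix.one_mul,
      sub_self]
  have horth : M.mulVec (z - lsSol M y) ⬝ᵥ (M.mulVec (lsSol M y) - y) = 0 := by
    rw [dotProduct_comm, Matrix.dotProduct_mulVec, ← Matrix.mulVec_transpose, hnormal,
      zero_dotProduct]
  have hsplit : M.mulVec z - y = M.mulVec (z - lsSol M y) + (M.mulVec (lsSol M y) - y) := by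
    rw [Matrix.mulVec_sub]; abel
  rw [hsplit, vnorm_sq, vnorm_sq, vnorm_sq, add_dotProduct, dotProduct_add, dotProduct_add, horth,
    dotProduct_comm (M.mulVec (lsSol M y) - y), horth]
  ring

lemma vnorm_mulVec_lsSol_sub_le {p k : ℕ} {M : Matrix (Fin p) (Fin k) ℝ}
    (hM : (Mᵀ * M).det ≠ 0) (y : Fin p → ℝ) (z : Fin k → ℝ) :
    vnorm (M.mulVec (lsSol M y) - y) ≤ vnorm (M.mulVec z - y) := by
  refine le_of_sq_le_sq ?_ (vnorm_nonneg _)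
  rw [vnorm_mulVec_sub_sq hM y z]
  exact le_add_of_nonneg_left (sq_nonneg _)

lemma mulVec_injective_of_det_ne_zero {p k : ℕ} {M : Matrix (Fin p) (Fin k) ℝ}
    (hM : (Mᵀ * M).det ≠ 0) : Function.Injective M.mulVec := by
  intro x z h
  have hinj := Matrix.mulVec_injective_iff_isUnit.2
    ((Matrix.isUnit_iff_isUnit_det _).2 (isUnit_iff_ne_zero.2 hM))
  apply hinj
  rw [← Matrix.mulVec_mulVec, ← Matrix.mulVec_mulVec, h]

lemma eq_lsSol_of_forall_le {p k : ℕ} {M : Matrix (Fin p) (Fin k) ℝ} (hM : (Mᵀ * M).det ≠ 0)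
    {y : Fin p → ℝ} {x : Fin k → ℝ} (hx : ∀ z, vnorm (M.mulVec x - y) ≤ vnorm (M.mulVec z - y)) :
    x = lsSol M y := by
  have h := pow_le_pow_left₀ (vnorm_nonneg _) (hx (lsSol M y)) 2
  rw [vnorm_mulVec_sub_sq hM y x] at h
  have h0 : vnorm (M.mulVec (x - lsSol M y)) = 0 := by
    rw [← sq_eq_zero_iff]
    exact le_antisymm (by linarith) (sq_nonneg _)
  rw [vnorm_eq_zero, Matrix.mulVec_sub, sub_eq_zero] at h0
  exact mulVec_injective_of_det_ne_zero hM h0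

lemma isMinNormLS_iff_eq_lsSol {p k : ℕ} {M : Matrix (Fin p) (Fin k) ℝ}
    (hM : (Mᵀ * M).det ≠ 0) {y : Fin p → ℝ} {x : Fin k → ℝ} :
    IsMinNormLS M y x ↔ x = lsSol M y := by
  refine ⟨fun h => eq_lsSol_of_forall_le hM h.1, ?_⟩
  rintro rfl
  exact ⟨vnorm_mulVec_lsSol_sub_le hM y, fun z hz => (eq_lsSol_of_forall_le hM hz) ▸ le_rfl⟩

lemma sigmaMin_le {m n : ℕ} (A : Matrix (Fin m) (Fin n) ℝ) {x : Fin n → ℝ} (hx : vnorm x = 1) :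
    sigmaMin A ≤ vnorm (A.mulVec x) :=
  csInf_le ⟨0, by rintro _ ⟨x, -, rfl⟩; exact vnorm_nonneg _⟩ ⟨x, hx, rfl⟩

lemma le_sigmaMin {m d : ℕ} (hd : 1 ≤ d) {A : Matrix (Fin m) (Fin d) ℝ} {c : ℝ}
    (h : ∀ x, vnorm x = 1 → c ≤ vnorm (A.mulVec x)) : c ≤ sigmaMin A := by
  obtain ⟨x, hx⟩ := exists_vnorm_eq_one hd
  refine le_csInf ⟨_, x, hx, rfl⟩ ?_
  rintro _ ⟨x, hx, rfl⟩
  exact h x hx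

open scoped Matrix.Norms.L2Operator in
lemma exists_vnorm_mulVec_le {m n : ℕ} (L : Matrix (Fin m) (Fin n) ℝ) :
    ∃ K : ℝ, 0 < K ∧ ∀ x, vnorm (L.mulVec x) ≤ K * vnorm x := by
  refine ⟨‖L‖ + 1, by positivity, fun x => ?_⟩
  have h := Matrix.l2_opNorm_mulVec L (WithLp.toLp 2 x)
  simp only [EuclideanSpace.norm_eq, Real.norm_eq_abs, sq_abs] at h
  exact h.trans (mul_le_mul_of_nonneg_right (by linarith) (Real.sqrt_nonneg _))

lemma sigmaMin_pos {m d : ℕ} (hd : 1 ≤ d) {A : Matrix (Fin m) (Fin d) ℝ}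
    (hA : Function.Injective A.mulVec) : 0 < sigmaMin A := by
  obtain ⟨K, hK, hL⟩ := exists_vnorm_mulVec_le ((Aᵀ * A)⁻¹ * Aᵀ)
  refine (inv_pos.2 hK).trans_le (le_sigmaMin hd fun x hx => ?_)
  have h := hL (A.mulVec x)
  rw [Matrix.mulVec_mulVec, Matrix.mul_assoc, Matrix.nonsing_inv_mul _
    (isUnit_iff_ne_zero.2 (det_transpose_mul_self_ne_zero hA)), Matrix.one_mulVec, hx] at h
  rwa [inv_le_iff_one_le_mul₀' hK]

/-- The sketching matrices that embed the column space of `M` with distortion `1 ± ε`. -/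
def embeddings (ε : ℝ) {m n k : ℕ} (M : Matrix (Fin n) (Fin k) ℝ) : Set (Fin m → Fin n → ℝ) :=
  {S | ∀ x : Fin k → ℝ,
    (1 - ε) * vnorm (M.mulVec x) ≤ vnorm ((Matrix.of S * M).mulVec x) ∧
    vnorm ((Matrix.of S * M).mulVec x) ≤ (1 + ε) * vnorm (M.mulVec x)}

lemma isClosed_embeddings (ε : ℝ) {m n k : ℕ} (M : Matrix (Fin n) (Fin k) ℝ) :
    IsClosed (embeddings ε M : Set (Fin m → Fin n → ℝ)) := by
  have hcont (x : Fin k → ℝ) : Continuous fun S : Fin m → Fin n → ℝ =>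
      vnorm ((Matrix.of S * M).mulVec x) :=
    continuous_vnorm.comp ((continuous_id.matrix_mul continuous_const).matrix_mulVec
      continuous_const)
  simp only [embeddings, Set.ofPred_forall, Set.ofPred_and]
  exact isClosed_iInter fun x =>
    (isClosed_le continuous_const (hcont x)).inter (isClosed_le (hcont x) continuous_const)

/-- The matrix `A` with the column `b` appended. -/
def appendCol {n d : ℕ} (A : Matrix (Fin n) (Fin d) ℝ) (b : Fin n → ℝ) :
    Matrix (Fin n) (Fin (d + 1)) ℝ :=
  Matrix.of fun i => Fin.snoc (A i) (b i)

lemma appendCol_mulVec_snoc {n d : ℕ} (A : Matrix (Fin n) (Fin d) ℝ) (b : Fin n → ℝ)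
    (z : Fin d → ℝ) (t : ℝ) :
    (appendCol A b).mulVec (Fin.snoc z t : Fin (d + 1) → ℝ) = A.mulVec z + t • b := by
  ext i
  simp [appendCol, Matrix.mulVec, dotProduct, Fin.sum_univ_castSucc, mul_comm]

lemma embeddings_bounds {ε : ℝ} {m n d : ℕ} {A : Matrix (Fin n) (Fin d) ℝ} {b : Fin n → ℝ}
    {S : Fin m → Fin n → ℝ} (hS : S ∈ embeddings ε (appendCol A b)) (z : Fin d → ℝ) (t : ℝ) :
    (1 - ε) * vnorm (A.mulVec z + t • b) ≤
        vnorm ((Matrix.of S * A).mulVec z + t • (Matrix.of S).mulVec b) ∧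
      vnorm ((Matrix.of S * A).mulVec z + t • (Matrix.of S).mulVec b) ≤
        (1 + ε) * vnorm (A.mulVec z + t • b) := by
  have h := hS (Fin.snoc z t)
  rwa [← Matrix.mulVec_mulVec, appendCol_mulVec_snoc, Matrix.mulVec_add, Matrix.mulVec_smul,
    Matrix.mulVec_mulVec] at h

lemma vnorm_mulVec_le_of_mem_embeddings {ε : ℝ} {m n d : ℕ} {A : Matrix (Fin n) (Fin d) ℝ}
    {b : Fin n → ℝ} {S : Fin m → Fin n → ℝ} (hS : S ∈ embeddings ε (appendCol A b))
    (z : Fin d → ℝ) : (1 - ε) * vnorm (A.mulVec z) ≤ vnorm ((Matrix.of S * A).mulVec z) := by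
  simpa using (embeddings_bounds hS z 0).1

lemma mulVec_injective_of_mem_embeddings {ε : ℝ} (hε : ε < 1) {m n d : ℕ}
    {A : Matrix (Fin n) (Fin d) ℝ} {b : Fin n → ℝ} {S : Fin m → Fin n → ℝ}
    (hA : Function.Injective A.mulVec) (hS : S ∈ embeddings ε (appendCol A b)) :
    Function.Injective (Matrix.of S * A).mulVec := by
  rw [← Matrix.coe_mulVecLin, ← LinearMap.ker_eq_bot, LinearMap.ker_eq_bot']
  intro x hx
  have h := vnorm_mulVec_le_of_mem_embeddings hS x
  rw [Matrix.coe_mulVecLin] at hx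
  rw [hx, vnorm_zero] at h
  have h0 : vnorm (A.mulVec x) = 0 :=
    le_antisymm (nonpos_of_mul_nonpos_right h (sub_pos.2 hε)) (vnorm_nonneg _)
  exact hA (by rw [vnorm_eq_zero.1 h0, Matrix.mulVec_zero])

lemma vnorm_residual_div_sigmaMin_le {ε : ℝ} (hε : ε ≤ 1 / 2) {m n d : ℕ} (hd : 1 ≤ d)
    {A : Matrix (Fin n) (Fin d) ℝ} {b : Fin n → ℝ} {S : Fin m → Fin n → ℝ}
    (hA : Function.Injective A.mulVec) (hS : S ∈ embeddings ε (appendCol A b)) :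
    vnorm ((Matrix.of S).mulVec b -
        (Matrix.of S * A).mulVec (lsSol (Matrix.of S * A) ((Matrix.of S).mulVec b))) /
        sigmaMin (Matrix.of S * A) ≤
      3 * (vnorm (b - A.mulVec (lsSol A b)) / sigmaMin A) := by
  have hSA := mulVec_injective_of_mem_embeddings (by linarith) hA hS
  have hσ := sigmaMin_pos hd hA
  have hσS : 1 / 2 * sigmaMin A ≤ sigmaMin (Matrix.of S * A) := by
    refine le_sigmaMin hd fun x hx => ?_
    calc 1 / 2 * sigmaMin A ≤ (1 - ε) * vnorm (A.mulVec x) :=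
          mul_le_mul (by linarith) (sigmaMin_le A hx) hσ.le (by linarith)
      _ ≤ _ := vnorm_mulVec_le_of_mem_embeddings hS x
  have hres : vnorm ((Matrix.of S).mulVec b -
      (Matrix.of S * A).mulVec (lsSol (Matrix.of S * A) ((Matrix.of S).mulVec b))) ≤
      3 / 2 * vnorm (b - A.mulVec (lsSol A b)) := by
    rw [vnorm_sub_comm, vnorm_sub_comm b]
    have h := (embeddings_bounds hS (lsSol A b) (-1)).2
    simp only [neg_smul, one_smul, ← sub_eq_add_neg] at h
    exact (vnorm_mulVec_lsSol_sub_le (det_transpose_mul_self_ne_zero hSA) _ _).trans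
      (h.trans (mul_le_mul_of_nonneg_right (by linarith) (vnorm_nonneg _)))
  calc _ ≤ (3 / 2 * vnorm (b - A.mulVec (lsSol A b))) / (1 / 2 * sigmaMin A) :=
        div_le_div₀ (mul_nonneg (by norm_num) (vnorm_nonneg _)) hres (by linarith) hσS
    _ = _ := by field_simp

lemma measure_inter_toReal_ge {α : Type*} [MeasurableSpace α] (μ : Measure α)
    [IsProbabilityMeasure μ] {s t : Set α} (hs : MeasurableSet s) {δ : ℝ}
    (h₁ : 1 - δ ≤ (μ s).toReal) (h₂ : 1 - δ ≤ (μ t).toReal) :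
    1 - 2 * δ ≤ (μ (s ∩ t)).toReal := by
  change 1 - δ ≤ μ.real s at h₁
  change 1 - δ ≤ μ.real t at h₂
  change 1 - 2 * δ ≤ μ.real (s ∩ t)
  have h := measureReal_inter_add_sdiff (μ := μ) (s := t) hs
  have hdiff : μ.real (t \ s) ≤ μ.real sᶜ := measureReal_mono fun x hx => hx.2
  rw [probReal_compl_eq_one_sub hs] at hdiff
  rw [Set.inter_comm]
  linarith

/-- A section-wise lower bound on the measure of a subset of a product; the set `G` of good
sections need not be measurable. -/
lemma mul_le_prod_toReal {α β : Type*} [MeasurableSpace α] [MeasurableSpace β]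
    (μ : Measure α) [IsProbabilityMeasure μ] (ν : Measure β) [IsProbabilityMeasure ν]
    {T : Set (α × β)} (hT : MeasurableSet T) {G : Set α} {p q : ℝ} (hq : 0 ≤ q)
    (hG : p ≤ (μ G).toReal) (hsec : ∀ x ∈ G, q ≤ (ν (Prod.mk x ⁻¹' T)).toReal) :
    q * p ≤ ((μ.prod ν) T).toReal := by
  have hmarkov : ENNReal.ofReal q * μ G ≤ (μ.prod ν) T := by
    rw [Measure.prod_apply hT]
    refine le_trans ?_ (mul_meas_ge_le_lintegral (measurable_measure_prodMk_left hT)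
      (ENNReal.ofReal q))
    gcongr
    intro x hx
    exact ENNReal.ofReal_le_of_le_toReal (hsec x hx)
  calc q * p ≤ q * (μ G).toReal := mul_le_mul_of_nonneg_left hG hq
    _ = (ENNReal.ofReal q * μ G).toReal := by rw [ENNReal.toReal_mul, ENNReal.toReal_ofReal hq]
    _ ≤ _ := ENNReal.toReal_mono (measure_ne_top _ _) hmarkov

lemma measurable_dotProduct_lsSol {α : Type*} [TopologicalSpace α] [MeasurableSpace α]
    [OpensMeasurableSpace α] {p k : ℕ} {M : α → Matrix (Fin p) (Fin k) ℝ} {y : α → Fin p → ℝ}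
    (hM : Continuous M) (hy : Continuous y) (a : Fin k → ℝ) :
    Measurable fun q => a ⬝ᵥ lsSol (M q) (y q) := by
  have hgram : Continuous fun q => (M q)ᵀ * M q := hM.matrix_transpose.matrix_mul hM
  have hadj : Continuous fun q => a ⬝ᵥ (((M q)ᵀ * M q).adjugate * (M q)ᵀ).mulVec (y q) :=
    continuous_const.dotProduct
      ((hgram.matrix_adjugate.matrix_mul hM.matrix_transpose).matrix_mulVec hy)
  have heq : (fun q => a ⬝ᵥ lsSol (M q) (y q)) = fun q => (((M q)ᵀ * M q).det)⁻¹ *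
      (a ⬝ᵥ (((M q)ᵀ * M q).adjugate * (M q)ᵀ).mulVec (y q)) := by
    funext q
    rw [lsSol, Matrix.inv_def, Ring.inverse_eq_inv', Matrix.smul_mul, Matrix.smul_mulVec,
      dotProduct_smul, smul_eq_mul]
  rw [heq]
  exact hgram.matrix_det.measurable.inv.mul hadj.measurable

/-- composing two sketching distributions that are both subspace embeddings
and both satisfy the generalization bound yields the generalization bound. -/
theorem stmt8 :
    ∃ C : ℝ, 0 < C ∧
    ∀ (ε δ : ℝ), 0 < ε → ε ≤ 1 / 2 → 0 < δ → δ < 1 / 4 →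
    ∀ (d : ℕ), 1 ≤ d →
    ∀ (C₀ : ℝ), 0 < C₀ →
    ∀ (n r m : ℕ)
      (μ₁ : Measure (Fin r → Fin n → ℝ)) (_ : IsProbabilityMeasure μ₁)
      (μ₂ : Measure (Fin m → Fin r → ℝ)) (_ : IsProbabilityMeasure μ₂),
      -- (i) each distribution is a (1 ± ε) subspace embedding for (d+1)-dimensional spaces
      (∀ M : Matrix (Fin n) (Fin (d + 1)) ℝ,
        1 - δ ≤ (μ₁ {S | ∀ x : Fin (d + 1) → ℝ,
          (1 - ε) * vnorm (M.mulVec x) ≤ vnorm ((Matrix.of S * M).mulVec x) ∧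
          vnorm ((Matrix.of S * M).mulVec x) ≤ (1 + ε) * vnorm (M.mulVec x)}).toReal) →
      (∀ M : Matrix (Fin r) (Fin (d + 1)) ℝ,
        1 - δ ≤ (μ₂ {R | ∀ x : Fin (d + 1) → ℝ,
          (1 - ε) * vnorm (M.mulVec x) ≤ vnorm ((Matrix.of R * M).mulVec x) ∧
          vnorm ((Matrix.of R * M).mulVec x) ≤ (1 + ε) * vnorm (M.mulVec x)}).toReal) →
      -- (ii) each distribution satisfies the generalization bound
      (∀ (A : Matrix (Fin n) (Fin d) ℝ), A.rank = d →
        ∀ (a : Fin d → ℝ) (b : Fin n → ℝ),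
        1 - δ ≤ (μ₁ {S | ∀ x' : Fin d → ℝ,
          IsMinNormLS (Matrix.of S * A) ((Matrix.of S).mulVec b) x' →
          |a ⬝ᵥ x' - a ⬝ᵥ ((Aᵀ * A)⁻¹ * Aᵀ).mulVec b| ≤
            C₀ * (ε / Real.sqrt d) * vnorm a *
              vnorm (b - A.mulVec (((Aᵀ * A)⁻¹ * Aᵀ).mulVec b)) / sigmaMin A}).toReal) →
      (∀ (A : Matrix (Fin r) (Fin d) ℝ), A.rank = d →
        ∀ (a : Fin d → ℝ) (b : Fin r → ℝ),
        1 - δ ≤ (μ₂ {R | ∀ x' : Fin d → ℝ,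
          IsMinNormLS (Matrix.of R * A) ((Matrix.of R).mulVec b) x' →
          |a ⬝ᵥ x' - a ⬝ᵥ ((Aᵀ * A)⁻¹ * Aᵀ).mulVec b| ≤
            C₀ * (ε / Real.sqrt d) * vnorm a *
              vnorm (b - A.mulVec (((Aᵀ * A)⁻¹ * Aᵀ).mulVec b)) / sigmaMin A}).toReal) →
      -- conclusion: the composition `R · S` satisfies the generalization bound
      ∀ (A : Matrix (Fin n) (Fin d) ℝ), A.rank = d →
      ∀ (a : Fin d → ℝ) (b : Fin n → ℝ),
      1 - C * δ ≤ ((μ₁.prod μ₂)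
        {q : (Fin r → Fin n → ℝ) × (Fin m → Fin r → ℝ) | ∀ x'' : Fin d → ℝ,
          IsMinNormLS (Matrix.of q.2 * (Matrix.of q.1 * A))
            ((Matrix.of q.2).mulVec ((Matrix.of q.1).mulVec b)) x'' →
          |a ⬝ᵥ x'' - a ⬝ᵥ ((Aᵀ * A)⁻¹ * Aᵀ).mulVec b| ≤
            C * C₀ * (ε / Real.sqrt d) * vnorm a *
              vnorm (b - A.mulVec (((Aᵀ * A)⁻¹ * Aᵀ).mulVec b)) / sigmaMin A}).toReal := by
  refine ⟨4, by norm_num, ?_⟩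
  intro ε δ hε hε' hδ hδ' d hd C₀ hC₀ n r m μ₁ _ μ₂ _ hE₁ hE₂ hB₁ hB₂ A hA a b
  have hAinj := (rank_eq_iff_mulVec_injective A).1 hA
  set c : ℝ := C₀ * (ε / Real.sqrt d) * vnorm a with hc
  have hc0 : 0 ≤ c := mul_nonneg (by positivity) (vnorm_nonneg a)
  let M : (Fin r → Fin n → ℝ) × (Fin m → Fin r → ℝ) → Matrix (Fin m) (Fin d) ℝ :=
    fun q => Matrix.of q.2 * (Matrix.of q.1 * A)
  let y : (Fin r → Fin n → ℝ) × (Fin m → Fin r → ℝ) → Fin m → ℝ :=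
    fun q => (Matrix.of q.2).mulVec ((Matrix.of q.1).mulVec b)
  let T : Set ((Fin r → Fin n → ℝ) × (Fin m → Fin r → ℝ)) :=
    {q | ((M q)ᵀ * M q).det ≠ 0 ∧ |a ⬝ᵥ lsSol (M q) (y q) - a ⬝ᵥ lsSol A b| ≤
      4 * c * (vnorm (b - A.mulVec (lsSol A b)) / sigmaMin A)}
  have hMc : Continuous M :=
    Continuous.matrix_mul continuous_snd (continuous_fst.matrix_mul continuous_const)
  have hyc : Continuous y :=
    Continuous.matrix_mulVec continuous_snd (continuous_fst.matrix_mulVec continuous_const)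
  have hT : MeasurableSet T :=
    (hMc.matrix_transpose.matrix_mul hMc).matrix_det.measurable
      (measurableSet_singleton 0).compl |>.inter
      (measurableSet_le (((measurable_dotProduct_lsSol hMc hyc a).sub_const _).abs)
        measurable_const)
  have hG := measure_inter_toReal_ge μ₁ (isClosed_embeddings ε (appendCol A b)).measurableSet
    (hE₁ (appendCol A b)) (hB₁ A hA a b)
  have hprod := mul_le_prod_toReal μ₁ μ₂ hT (q := 1 - 2 * δ) (by linarith) hG ?_
  · refine le_trans (by nlinarith) (hprod.trans (ENNReal.toReal_mono (measure_ne_top _ _)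
      (measure_mono ?_)))
    rintro q ⟨hdet, hq⟩ x hx
    rw [(isMinNormLS_iff_eq_lsSol hdet).1 hx]
    refine hq.trans_eq ?_
    rw [hc, lsSol]
    ring
  · rintro S ⟨hS, hSb⟩
    have hSA := mulVec_injective_of_mem_embeddings (by linarith) hAinj hS
    refine (measure_inter_toReal_ge μ₂ (isClosed_embeddings ε (appendCol (Matrix.of S * A)
      ((Matrix.of S).mulVec b))).measurableSet (hE₂ _)
      (hB₂ (Matrix.of S * A) ((rank_eq_iff_mulVec_injective _).2 hSA) a
        ((Matrix.of S).mulVec b))).trans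
      (ENNReal.toReal_mono (measure_ne_top _ _) (measure_mono ?_))
    rintro R ⟨hR, hRb⟩
    have hdet := det_transpose_mul_self_ne_zero
      (mulVec_injective_of_mem_embeddings (by linarith) hSA hR)
    refine ⟨hdet, ?_⟩
    have h₁ := hSb _ ((isMinNormLS_iff_eq_lsSol (det_transpose_mul_self_ne_zero hSA)).2 rfl)
    have h₂ := hRb _ ((isMinNormLS_iff_eq_lsSol hdet).2 rfl)
    have h₃ := mul_le_mul_of_nonneg_left
      (vnorm_residual_div_sigmaMin_le hε' hd hAinj hS) hc0
    rw [← lsSol, ← hc, mul_div_assoc] at h₁ h₂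
    refine (abs_sub_le _ (a ⬝ᵥ lsSol (Matrix.of S * A) ((Matrix.of S).mulVec b)) _).trans
      ((add_le_add (h₂.trans h₃) h₁).trans_eq ?_)
    ring
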